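/- Let K be a field with a surjective additive valuation v : K → ℝ∞, let m ≥ 2, let E := {(i,j) : 1 ≤ i < j ≤ m}, and let I ⊆ K[x_e : e ∈ E] be the kernel of the K-algebra homomorphism K[x_e : e ∈ E] → K[y_1,…,y_m,z_1,…,z_m] sending x_{ij} ↦ y_i z_j − y_j z_i (so B := K[x_e]/I is the coordinate ring of the affine cone over the Grassmannian Gr(2,m)). Take the weights a_{ij} := e_i + e_j ∈ ℤ^m for (i,j) ∈ E; then I is weight-homogeneous, and μ : ℝ^m × X^an → X^an is defined. There exists a continuous map σ : Trop(X) → X^an such that trop(σ(ξ)) = ξ for all ξ ∈ Trop(X), and which is ℝ^m-equivariant: for every ξ ∈ Trop(X) and τ ∈ ℝ^m, the point ξ + Aτ (where (Aτ)_{ij} := τ_i + τ_j, added coordinatewise in ℝ∞) lies in Trop(X) and σ(ξ + Aτ) = μ(τ, σ(ξ)). -/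

import Mathlib

open scoped Classical

noncomputable section

/-- `ℝ∞ = ℝ ∪ {∞}`, with the order topology. -/
abbrev RInf := WithTop ℝ

noncomputable instance : TopologicalSpace RInf := Preorder.topology RInf
instance : OrderTopology RInf := ⟨rfl⟩

/-- An additive (non-Archimedean) valuation on a commutative ring, with values in
`ℝ∞`: `w(ab) = w(a) + w(b)`, `w(a+b) ≥ min (w a) (w b)`, `w 1 = 0`, `w 0 = ∞`. -/
structure IsVal {R : Type*} [CommRing R] (w : R → RInf) : Prop where
  map_mul : ∀ a b, w (a * b) = w a + w b
  min_le_add : ∀ a b, min (w a) (w b) ≤ w (a + b)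
  map_one : w 1 = 0
  map_zero : w 0 = ⊤

/-- The analytification of `Spec B`: the set of additive valuations on the `K`-algebra
`B` extending the valuation `v` on `K`, as a subset of the product space `B → ℝ∞`
(topology of pointwise convergence). -/
def An {K : Type*} [Field K] (v : K → RInf) (B : Type*) [CommRing B] [Algebra K B] :
    Set (B → RInf) :=
  {w | IsVal w ∧ ∀ c : K, w (algebraMap K B c) = v c}

variable {K : Type*} [Field K] {ι M : Type*} [Fintype M]

/-- Weight of a monomial exponent `α` with respect to weight vectors `a`. -/
def wt (a : ι → M → ℤ) (α : ι →₀ ℕ) : M → ℤ :=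
  α.sum fun i k => (k : ℤ) • a i

/-- The weight-`β` component `F_β` of a polynomial `F`: the sum of the terms `c·x^α`
of `F` with `Σ_i α_i a_i = β`. -/
def wtComp (a : ι → M → ℤ) (F : MvPolynomial ι K) (β : M → ℤ) : MvPolynomial ι K :=
  ∑ α ∈ F.support.filter (fun α => wt a α = β), MvPolynomial.monomial α (F.coeff α)

/-- An ideal is weight-homogeneous if it contains all weight components of its
members. -/
def WtHomog (a : ι → M → ℤ) (I : Ideal (MvPolynomial ι K)) : Prop :=
  ∀ F ∈ I, ∀ β : M → ℤ, wtComp a F β ∈ I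

/-- Pairing `β·τ` of an integer vector with a real vector. -/
def pairR (β : M → ℤ) (τ : M → ℝ) : ℝ := ∑ j, (β j : ℝ) * τ j

/-- `ν(F) = min_β (w(F̄_β) + β·τ)`: the minimum over the finitely many `β` with
`F_β ≠ 0`, with value `∞` for `F = 0`. -/
def muAux (a : ι → M → ℤ) (I : Ideal (MvPolynomial ι K))
    (w : (MvPolynomial ι K ⧸ I) → RInf) (τ : M → ℝ) (F : MvPolynomial ι K) : RInf :=
  (F.support.image (wt a)).inf fun β =>
    w (Ideal.Quotient.mk I (wtComp a F β)) + ((pairR β τ : ℝ) : RInf)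

/-- `μ(τ,w) : B → ℝ∞`, computed on an arbitrary lift of `f` (for weight-homogeneous
`I` this is independent of the lift). -/
def mu (a : ι → M → ℤ) (I : Ideal (MvPolynomial ι K)) (τ : M → ℝ)
    (w : (MvPolynomial ι K ⧸ I) → RInf) : (MvPolynomial ι K ⧸ I) → RInf :=
  fun f => muAux a I w τ (Function.surjInv Ideal.Quotient.mk_surjective f)

/-- The tropicalisation map `X^an → ℝ∞^ι`, `w ↦ (w(x̄_i))_i`. -/
def tropMap (I : Ideal (MvPolynomial ι K)) (w : (MvPolynomial ι K ⧸ I) → RInf) :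
    ι → RInf :=
  fun i => w (Ideal.Quotient.mk I (MvPolynomial.X i))

/-- `Trop(X)`: the image of the analytification under `trop`, inside `ℝ∞^ι`. -/
def TropSet (v : K → RInf) (I : Ideal (MvPolynomial ι K)) : Set (ι → RInf) :=
  {η | ∃ w ∈ An v (MvPolynomial ι K ⧸ I), tropMap I w = η}

/-- `Trop(X⁰)`: the points of `Trop(X)` with all coordinates finite, inside `ℝ^ι`. -/
def TropSet0 (v : K → RInf) (I : Ideal (MvPolynomial ι K)) : Set (ι → ℝ) :=
  {ξ | ∃ w ∈ An v (MvPolynomial ι K ⧸ I), ∀ i, tropMap I w i = ((ξ i : ℝ) : RInf)}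

end

/-- The index set `E = {(i,j) : 1 ≤ i < j ≤ m}`. -/
abbrev GrVar (m : ℕ) := {e : Fin m × Fin m // e.1 < e.2}

/-- The ideal of the affine cone over the Grassmannian `Gr(2,m)`: the kernel of
`x_{ij} ↦ y_i z_j − y_j z_i`. -/
noncomputable def grIdeal (K : Type*) [Field K] (m : ℕ) :
    Ideal (MvPolynomial (GrVar m) K) :=
  RingHom.ker (MvPolynomial.aeval (fun e : GrVar m =>
    (MvPolynomial.X (Sum.inl e.val.1) * MvPolynomial.X (Sum.inr e.val.2)
      - MvPolynomial.X (Sum.inl e.val.2) * MvPolynomial.X (Sum.inr e.val.1)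
      : MvPolynomial (Fin m ⊕ Fin m) K)))

/-- The weights `a_{ij} = e_i + e_j ∈ ℤ^m`. -/
noncomputable def grWt (m : ℕ) : GrVar m → Fin m → ℤ :=
  fun e => Pi.single e.val.1 1 + Pi.single e.val.2 1

namespace RInf

lemma exists_coe {x : RInf} (hx : x ≠ ⊤) : ∃ r : ℝ, (r : RInf) = x :=
  WithTop.ne_top_iff_exists.mp hx

lemma add_neg_coe_le_iff {a b : RInf} (r : ℝ) :
    a + ((-r : ℝ) : RInf) ≤ b ↔ a ≤ b + (r : RInf) := by
  rw [← WithTop.add_le_add_iff_right (z := (r : RInf)) WithTop.coe_ne_top, add_assoc,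
    ← WithTop.coe_add, neg_add_cancel, WithTop.coe_zero, add_zero]

lemma isEmbedding_coe_eReal : Topology.IsEmbedding (fun x : RInf => (WithBot.some x : EReal)) := by
  let f : RInf ↪o EReal := WithBot.coeOrderHom
  refine f.isEmbedding_of_ordConnected ⟨?_⟩
  rintro _ ⟨x, rfl⟩ _ ⟨y, rfl⟩ z hz
  induction z using WithBot.recBotCoe with
  | bot => exact absurd hz.1 (by
      change ¬ ((x : WithBot RInf) ≤ ⊥)
      simp)
  | coe z => exact ⟨z, rfl⟩

instance : ContinuousAdd RInf where
  continuous_add := by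
    rw [isEmbedding_coe_eReal.continuous_iff]
    have key : Continuous fun p : RInf × RInf =>
        (WithBot.some p.1 : EReal) + (WithBot.some p.2 : EReal) := by
      rw [continuous_iff_continuousAt]
      intro p
      have h : ContinuousAt (fun q : EReal × EReal => q.1 + q.2)
          ((WithBot.some p.1 : EReal), (WithBot.some p.2 : EReal)) :=
        EReal.continuousAt_add (Or.inr WithBot.coe_ne_bot) (Or.inl WithBot.coe_ne_bot)
      exact ContinuousAt.comp (f := fun p : RInf × RInf =>
        ((WithBot.some p.1 : EReal), (WithBot.some p.2 : EReal))) h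
        ((isEmbedding_coe_eReal.continuous.comp continuous_fst).prodMk
          (isEmbedding_coe_eReal.continuous.comp continuous_snd)).continuousAt
    exact key

end RInf

namespace IsVal

variable {R : Type*} [CommRing R] {w : R → RInf}

lemma map_neg_one (hw : IsVal w) : w (-1) = 0 := by
  have h := hw.map_mul (-1) (-1)
  rw [neg_mul_neg, one_mul, hw.map_one] at h
  rcases eq_or_ne (w (-1)) ⊤ with ht | ht
  · rw [ht] at h; simp at h
  · obtain ⟨r, hr⟩ := RInf.exists_coe ht
    rw [← hr] at h ⊢
    norm_cast at h ⊢
    linarith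

lemma map_neg (hw : IsVal w) (a : R) : w (-a) = w a := by
  rw [← neg_one_mul, hw.map_mul, hw.map_neg_one, zero_add]

lemma min_le_sub (hw : IsVal w) (a b : R) : min (w a) (w b) ≤ w (a - b) := by
  rw [sub_eq_add_neg, ← hw.map_neg b]
  exact hw.min_le_add _ _

lemma le_sum (hw : IsVal w) {ι : Type*} (s : Finset ι) (f : ι → R) {c : RInf}
    (h : ∀ i ∈ s, c ≤ w (f i)) : c ≤ w (∑ i ∈ s, f i) := by
  induction s using Finset.induction_on with
  | empty => simp [hw.map_zero]
  | insert a s ha ih =>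
    rw [Finset.sum_insert ha]
    exact (le_min (h a (Finset.mem_insert_self a s))
      (ih fun i hi => h i (Finset.mem_insert_of_mem hi))).trans (hw.min_le_add _ _)

lemma map_pow (hw : IsVal w) (a : R) (n : ℕ) : w (a ^ n) = n • w a := by
  induction n with
  | zero => simp [hw.map_one]
  | succ n ih => rw [pow_succ, hw.map_mul, ih, succ_nsmul]

lemma map_prod (hw : IsVal w) {ι : Type*} (s : Finset ι) (f : ι → R) :
    w (∏ i ∈ s, f i) = ∑ i ∈ s, w (f i) := by
  induction s using Finset.induction_on with
  | empty => simp [hw.map_one]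
  | insert a s ha ih => rw [Finset.prod_insert ha, Finset.sum_insert ha, hw.map_mul, ih]

/-- The summand of strictly smallest valuation determines the valuation of a sum. -/
lemma map_add_of_lt (hw : IsVal w) {a b : R} (h : w a < w b) : w (a + b) = w a := by
  apply le_antisymm
  · by_contra! hlt
    have := hw.min_le_sub (a + b) b
    rw [add_sub_cancel_right] at this
    exact absurd this (not_le.mpr (lt_min hlt h))
  · exact (min_eq_left h.le).symm.le.trans (hw.min_le_add a b)

lemma comp (hw : IsVal w) {S : Type*} [CommRing S] (f : S →+* R) : IsVal fun x => w (f x) where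
  map_mul a b := by rw [_root_.map_mul, hw.map_mul]
  min_le_add a b := by rw [map_add]; exact hw.min_le_add _ _
  map_one := by rw [_root_.map_one, hw.map_one]
  map_zero := by rw [_root_.map_zero, hw.map_zero]

/-- A valuation on a commutative ring is induced by a valuation on some field. -/
lemma exists_field.{u} {R : Type u} [CommRing R] {w : R → RInf} (hw : IsVal w) :
    ∃ (F : Type u) (_ : Field F) (f : R →+* F) (w' : F → RInf),
      IsVal w' ∧ ∀ x, w' (f x) = w x := by
  let V : AddValuation R RInf :=
    AddValuation.of w hw.map_zero hw.map_one hw.min_le_add hw.map_mul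
  let V₁ := V.toValuation.onQuot (le_refl V.toValuation.supp)
  have hprime : V.toValuation.supp.IsPrime := inferInstance
  let V₂ := V₁.extendToLocalization (S := nonZeroDivisors (R ⧸ V.toValuation.supp)) (by
    intro x hx hx'
    have : V₁.supp = ⊥ := by
      rw [Valuation.supp_quot, Ideal.map_quotient_self]
    rw [SetLike.mem_coe, this, Ideal.mem_bot] at hx'
    exact nonZeroDivisors.ne_zero hx hx') (FractionRing (R ⧸ V.toValuation.supp))
  let W := AddValuation.ofValuation V₂
  refine ⟨FractionRing (R ⧸ V.toValuation.supp), inferInstance,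
    (algebraMap (R ⧸ V.toValuation.supp) _).comp (Ideal.Quotient.mk _), W,
    ⟨W.map_mul, W.map_add, W.map_one, W.map_zero⟩, fun x => ?_⟩
  change V₂ (algebraMap (R ⧸ V.toValuation.supp) _ (Ideal.Quotient.mk _ x)) = V.toValuation x
  exact (Valuation.extendToLocalization_apply_map_apply _ _ _ _).trans rfl

end IsVal

/-- The Gauss (monomial) extension of `v : R → ℝ∞` to polynomials, giving the variable `i`
the value `ω i`. -/
noncomputable def gauss {R σ : Type*} [CommRing R] (v : R → RInf) (ω : σ → RInf)
    (F : MvPolynomial σ R) : RInf :=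
  F.support.inf fun α => v (F.coeff α) + α.sum fun i k => k • ω i

section Gauss

variable {R σ : Type*} [CommRing R] {v : R → RInf}

lemma monomial_weight_add (ω : σ → RInf) (α β : σ →₀ ℕ) :
    ((α + β).sum fun i k => k • ω i)
      = (α.sum fun i k => k • ω i) + β.sum fun i k => k • ω i :=
  Finsupp.sum_add_index' (fun _ => zero_nsmul _) fun _ _ _ => add_nsmul _ _ _

lemma gauss_le (hv : IsVal v) (ω : σ → RInf) (F : MvPolynomial σ R) (α : σ →₀ ℕ) :
    gauss v ω F ≤ v (F.coeff α) + α.sum fun i k => k • ω i := by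
  by_cases h : α ∈ F.support
  · exact Finset.inf_le h
  · rw [MvPolynomial.notMem_support_iff.mp h, hv.map_zero, top_add]
    exact le_top

lemma le_gauss {ω : σ → RInf} {F : MvPolynomial σ R} {c : RInf}
    (h : ∀ α ∈ F.support, c ≤ v (F.coeff α) + α.sum fun i k => k • ω i) : c ≤ gauss v ω F :=
  Finset.le_inf h

lemma le_gauss_of_isVal {S : Type*} [CommRing S] {w : S → RInf} (hw : IsVal w)
    (f : R →+* S) (g : σ → S) {ω : σ → RInf} (hf : ∀ c, v c ≤ w (f c))
    (hg : ∀ i, ω i ≤ w (g i)) (F : MvPolynomial σ R) :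
    gauss v ω F ≤ w (MvPolynomial.eval₂Hom f g F) := by
  rw [MvPolynomial.coe_eval₂Hom, MvPolynomial.eval₂_eq]
  refine hw.le_sum _ _ fun α hα => (Finset.inf_le hα).trans ?_
  rw [hw.map_mul, hw.map_prod]
  refine add_le_add (hf _) (Finset.sum_le_sum fun i _ => ?_)
  rw [hw.map_pow]
  exact nsmul_le_nsmul_right (hg i) _

lemma gauss_min_le_add (hv : IsVal v) (ω : σ → RInf) (F G : MvPolynomial σ R) :
    min (gauss v ω F) (gauss v ω G) ≤ gauss v ω (F + G) := by
  refine le_gauss fun α _ => ?_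
  rw [MvPolynomial.coeff_add]
  calc _ ≤ min (v (F.coeff α) + α.sum fun i k => k • ω i)
        (v (G.coeff α) + α.sum fun i k => k • ω i) :=
          min_le_min (gauss_le hv _ _ _) (gauss_le hv _ _ _)
    _ = min (v (F.coeff α)) (v (G.coeff α)) + α.sum fun i k => k • ω i :=
          min_add_add_right _ _ _
    _ ≤ _ := by gcongr; exact hv.min_le_add _ _

lemma gauss_add_le_mul (hv : IsVal v) (ω : σ → RInf) (F G : MvPolynomial σ R) :
    gauss v ω F + gauss v ω G ≤ gauss v ω (F * G) := by
  refine le_gauss fun γ _ => ?_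
  rw [MvPolynomial.coeff_mul]
  rcases eq_or_ne (γ.sum fun i k => k • ω i) ⊤ with ht | ht
  · rw [ht, add_top]; exact le_top
  · obtain ⟨r, hr⟩ := RInf.exists_coe ht
    rw [← hr, ← RInf.add_neg_coe_le_iff]
    refine hv.le_sum _ _ fun p hp => ?_
    rw [RInf.add_neg_coe_le_iff, hr, hv.map_mul,
      ← Finset.HasAntidiagonal.mem_antidiagonal.mp hp, monomial_weight_add, add_add_add_comm]
    exact add_le_add (gauss_le hv _ _ _) (gauss_le hv _ _ _)

lemma gauss_mul_le (hv : IsVal v) (ω : σ → RInf) (F G : MvPolynomial σ R) :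
    gauss v ω (F * G) ≤ gauss v ω F + gauss v ω G := by
  rcases eq_or_ne (gauss v ω F) ⊤ with hF | hF
  · rw [hF, top_add]; exact le_top
  rcases eq_or_ne (gauss v ω G) ⊤ with hG | hG
  · rw [hG, add_top]; exact le_top
  let t : MvPolynomial σ R → (σ →₀ ℕ) → RInf := fun H α =>
    v (H.coeff α) + α.sum fun i k => k • ω i
  have attained : ∀ H : MvPolynomial σ R, gauss v ω H ≠ ⊤ →
      (H.support.filter fun α => t H α = gauss v ω H).Nonempty := by
    intro H hH
    have hne : H.support.Nonempty := by
      by_contra h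
      rw [Finset.not_nonempty_iff_eq_empty] at h
      exact hH (by rw [gauss, h, Finset.inf_empty])
    obtain ⟨α, hα, h⟩ := Finset.exists_mem_eq_inf H.support hne (t H)
    exact ⟨α, Finset.mem_filter.mpr ⟨hα, h.symm⟩⟩
  obtain ⟨α, hα, β, hβ, huniq⟩ :=
    UniqueSums.uniqueAdd_of_nonempty (attained F hF) (attained G hG)
  obtain ⟨hαs, hα⟩ := Finset.mem_filter.mp hα
  obtain ⟨hβs, hβ⟩ := Finset.mem_filter.mp hβ
  have lt_of_ne : ∀ p ∈ (Finset.HasAntidiagonal.antidiagonal (α + β)).erase (α, β),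
      gauss v ω F + gauss v ω G < t F p.1 + t G p.2 ∨ v (F.coeff p.1 * G.coeff p.2) = ⊤ := by
    intro p hp
    obtain ⟨hne, hp⟩ := Finset.mem_erase.mp hp
    rw [Finset.HasAntidiagonal.mem_antidiagonal] at hp
    by_cases h1 : p.1 ∈ F.support
    · by_cases h2 : p.2 ∈ G.support
      · left
        by_cases e1 : t F p.1 = gauss v ω F
        · have e2 : t G p.2 ≠ gauss v ω G := fun e2 => hne (by
            obtain ⟨a, b⟩ := huniq (Finset.mem_filter.mpr ⟨h1, e1⟩)
              (Finset.mem_filter.mpr ⟨h2, e2⟩) hp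
            exact Prod.ext a b)
          rw [e1]
          exact WithTop.add_lt_add_left hF (lt_of_le_of_ne (gauss_le hv _ _ _) e2.symm)
        · refine lt_of_lt_of_le
            (WithTop.add_lt_add_right hG (lt_of_le_of_ne (gauss_le hv _ _ _) (Ne.symm e1))) ?_
          exact add_le_add le_rfl (gauss_le hv _ _ _)
      · right; rw [MvPolynomial.notMem_support_iff.mp h2, mul_zero, hv.map_zero]
    · right; rw [MvPolynomial.notMem_support_iff.mp h1, zero_mul, hv.map_zero]
  have hfin : t F α + t G β ≠ ⊤ := by
    rw [hα, hβ]; exact WithTop.add_ne_top.mpr ⟨hF, hG⟩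
  have hsplit : ∀ a b, t F a + t G b
      = v (F.coeff a * G.coeff b) + (a + b).sum fun i k => k • ω i := by
    intro a b
    rw [hv.map_mul, monomial_weight_add, add_add_add_comm]
  rw [hsplit] at hfin
  obtain ⟨hfin1, hfin2⟩ := WithTop.add_ne_top.mp hfin
  have hcoeff : v ((F * G).coeff (α + β)) = v (F.coeff α * G.coeff β) := by
    rw [MvPolynomial.coeff_mul, ← Finset.add_sum_erase _ _
      (Finset.HasAntidiagonal.mem_antidiagonal.mpr (rfl : (α, β).1 + (α, β).2 = α + β))]
    obtain ⟨r, hr⟩ := RInf.exists_coe hfin1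
    by_cases hemp : ((Finset.HasAntidiagonal.antidiagonal (α + β)).erase (α, β)).Nonempty
    · obtain ⟨q, hq, hmin⟩ := Finset.exists_min_image _
        (fun p : (σ →₀ ℕ) × (σ →₀ ℕ) => v (F.coeff p.1 * G.coeff p.2)) hemp
      refine hv.map_add_of_lt (lt_of_lt_of_le ?_ (hv.le_sum _ _ hmin))
      rcases lt_of_ne q hq with h | h
      · rw [← hα, ← hβ, hsplit, hsplit,
          Finset.HasAntidiagonal.mem_antidiagonal.mp (Finset.mem_of_mem_erase hq)] at h
        exact lt_of_add_lt_add_right h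
      · rw [h]; exact lt_top_iff_ne_top.mpr hfin1
    · rw [Finset.not_nonempty_iff_eq_empty.mp hemp, Finset.sum_empty, add_zero]
  refine (gauss_le hv ω (F * G) (α + β)).trans ?_
  rw [hcoeff, ← hsplit, hα, hβ]

lemma gauss_C (hv : IsVal v) (ω : σ → RInf) (c : R) :
    gauss v ω (MvPolynomial.C c) = v c := by
  apply le_antisymm
  · simpa using gauss_le hv ω (MvPolynomial.C c) 0
  · refine le_gauss fun α hα => ?_
    rw [MvPolynomial.mem_support_iff, MvPolynomial.coeff_C] at hα
    have : 0 = α := by by_contra h; simp [h] at hα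
    subst this
    simp

lemma gauss_isVal (hv : IsVal v) (ω : σ → RInf) : IsVal (gauss v ω) where
  map_mul F G := le_antisymm (gauss_mul_le hv ω F G) (gauss_add_le_mul hv ω F G)
  min_le_add := gauss_min_le_add hv ω
  map_one := by rw [← MvPolynomial.C_1, gauss_C hv, hv.map_one]
  map_zero := by simp [gauss]

lemma gauss_X (hv : IsVal v) (ω : σ → RInf) (i : σ) :
    gauss v ω (MvPolynomial.X i : MvPolynomial σ R) = ω i := by
  apply le_antisymm
  · simpa [hv.map_one] using gauss_le hv ω (MvPolynomial.X i) (Finsupp.single i 1)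
  · refine le_gauss fun α hα => ?_
    rw [MvPolynomial.mem_support_iff, MvPolynomial.coeff_X] at hα
    have : Finsupp.single i 1 = α := by by_contra h; simp [h] at hα
    subst this
    simp [hv.map_one]

lemma continuous_gauss (v : R → RInf) (F : MvPolynomial σ R) :
    Continuous fun ω : σ → RInf => gauss v ω F :=
  Continuous.finset_inf_apply fun _ _ => continuous_const.add
    (continuous_finsetSum _ fun i _ => (continuous_apply i).nsmul _)

end Gauss

section Weights

variable {K ι κ M : Type*} [Field K]

lemma wt_eq_weight (a : ι → M → ℤ) (α : ι →₀ ℕ) : wt a α = Finsupp.weight a α := by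
  rw [Finsupp.weight_apply]
  simp [wt]

lemma wtComp_eq_component [Fintype M] (a : ι → M → ℤ) (F : MvPolynomial ι K) (β : M → ℤ) :
    wtComp a F β = MvPolynomial.weightedHomogeneousComponent a β F := by
  rw [MvPolynomial.weightedHomogeneousComponent_apply]
  simp only [wtComp, wt_eq_weight]

/-- Homomorphisms sending variables to homogeneous elements commute with taking weight
components. -/
lemma map_wtComp [Fintype M] (a : ι → M → ℤ) (b : κ → M → ℤ)
    (f : MvPolynomial ι K →ₐ[K] MvPolynomial κ K)
    (hf : ∀ i, MvPolynomial.IsWeightedHomogeneous b (f (MvPolynomial.X i)) (a i))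
    (F : MvPolynomial ι K) (β : M → ℤ) : f (wtComp a F β) = wtComp b (f F) β := by
  rw [wtComp_eq_component, wtComp_eq_component]
  induction F using MvPolynomial.induction_on' with
  | add p q hp hq => rw [map_add, map_add, map_add, map_add, hp, hq]
  | monomial α c =>
    have h1 : MvPolynomial.IsWeightedHomogeneous b (f (MvPolynomial.monomial α c))
        (Finsupp.weight a α) := by
      rw [MvPolynomial.monomial_eq, map_mul, ← MvPolynomial.algebraMap_eq, AlgHom.commutes,
        Finsupp.weight_apply, Finsupp.prod, map_prod, Finsupp.sum, ← zero_add (Finset.sum _ _)]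
      refine (MvPolynomial.isWeightedHomogeneous_C b c).mul
        (MvPolynomial.IsWeightedHomogeneous.prod _ _ _ fun i _ => ?_)
      rw [map_pow]
      exact (hf i).pow _
    have h2 := MvPolynomial.isWeightedHomogeneous_monomial a α c rfl
    rw [MvPolynomial.weightedHomogeneousComponent_of_mem
        ((MvPolynomial.mem_weightedHomogeneousSubmodule K _ _ _).mpr h2),
      MvPolynomial.weightedHomogeneousComponent_of_mem
        ((MvPolynomial.mem_weightedHomogeneousSubmodule K _ _ _).mpr h1)]
    split_ifs <;> simp

end Weights

section Plucker

variable {K : Type*} [Field K] {m : ℕ}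

/-- The homomorphism `x_{ij} ↦ y_i z_j - y_j z_i`. -/
noncomputable def minorHom (K : Type*) [Field K] (m : ℕ) :
    MvPolynomial (GrVar m) K →ₐ[K] MvPolynomial (Fin m ⊕ Fin m) K :=
  MvPolynomial.aeval (fun e : GrVar m =>
    (MvPolynomial.X (Sum.inl e.val.1) * MvPolynomial.X (Sum.inr e.val.2)
      - MvPolynomial.X (Sum.inl e.val.2) * MvPolynomial.X (Sum.inr e.val.1)))

lemma mem_grIdeal {F : MvPolynomial (GrVar m) K} : F ∈ grIdeal K m ↔ minorHom K m F = 0 :=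
  Iff.rfl

lemma wtHomog_grIdeal : WtHomog (grWt m) (grIdeal K m) := by
  intro F hF β
  rw [mem_grIdeal] at hF ⊢
  rw [map_wtComp (grWt m) (Sum.elim (fun i => Pi.single i 1) fun i => Pi.single i 1), hF,
    wtComp_eq_component, map_zero]
  intro e
  rw [minorHom, MvPolynomial.aeval_X]
  refine MvPolynomial.IsWeightedHomogeneous.sub ?_ ?_
  · exact (MvPolynomial.isWeightedHomogeneous_X K _ _).mul
      (MvPolynomial.isWeightedHomogeneous_X K _ _)
  · rw [grWt, add_comm]
    exact (MvPolynomial.isWeightedHomogeneous_X K _ _).mul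
      (MvPolynomial.isWeightedHomogeneous_X K _ _)

/-- The antisymmetric family of Plücker variables. -/
noncomputable def pluckerVar (K : Type*) [Field K] {m : ℕ} (k l : Fin m) :
    MvPolynomial (GrVar m) K :=
  if h : k < l then MvPolynomial.X ⟨(k, l), h⟩
  else if h : l < k then -MvPolynomial.X ⟨(l, k), h⟩ else 0

/-- The antisymmetric family of Plücker coordinates in the coordinate ring. -/
noncomputable def plucker (K : Type*) [Field K] {m : ℕ} (k l : Fin m) :
    MvPolynomial (GrVar m) K ⧸ grIdeal K m :=
  Ideal.Quotient.mk _ (pluckerVar K k l)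

lemma minorHom_pluckerVar (k l : Fin m) : minorHom K m (pluckerVar K k l)
    = MvPolynomial.X (Sum.inl k) * MvPolynomial.X (Sum.inr l)
      - MvPolynomial.X (Sum.inl l) * MvPolynomial.X (Sum.inr k) := by
  unfold pluckerVar
  split_ifs with h h'
  · simp [minorHom]
  · simp [minorHom]
  · obtain rfl : k = l := le_antisymm (not_lt.mp h') (not_lt.mp h)
    simp

lemma plucker_self (k : Fin m) : plucker K k k = 0 := by
  simp [plucker, pluckerVar]

lemma plucker_swap (k l : Fin m) : plucker K l k = -plucker K k l := by
  rcases lt_trichotomy k l with h | rfl | h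
  · simp [plucker, pluckerVar, h, h.not_gt]
  · simp [plucker_self]
  · simp [plucker, pluckerVar, h, h.not_gt]

lemma plucker_of_lt {k l : Fin m} (h : k < l) :
    plucker K k l = Ideal.Quotient.mk _ (MvPolynomial.X ⟨(k, l), h⟩) := by
  rw [plucker, pluckerVar, dif_pos h]

lemma plucker_relation (i j k l : Fin m) :
    plucker K i j * plucker K k l - plucker K i k * plucker K j l
      + plucker K i l * plucker K j k = 0 := by
  simp only [plucker, ← map_mul, ← map_sub, ← map_add]
  rw [Ideal.Quotient.eq_zero_iff_mem, mem_grIdeal]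
  simp only [map_add, map_sub, map_mul, minorHom_pluckerVar]
  ring

/-- The coordinates of a point of `ℝ∞^E`, extended symmetrically by `∞` on the diagonal. -/
noncomputable def symCoord {m : ℕ} (ξ : GrVar m → RInf) (k l : Fin m) : RInf :=
  if h : k < l then ξ ⟨(k, l), h⟩ else if h : l < k then ξ ⟨(l, k), h⟩ else ⊤

lemma continuous_symCoord (k l : Fin m) :
    Continuous fun ξ : GrVar m → RInf => symCoord ξ k l := by
  unfold symCoord
  split_ifs
  · exact continuous_apply _
  · exact continuous_apply _
  · exact continuous_const

lemma IsVal.plucker_eq_symCoord {w : (MvPolynomial (GrVar m) K ⧸ grIdeal K m) → RInf}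
    (hw : IsVal w) (k l : Fin m) :
    w (plucker K k l) = symCoord (tropMap (grIdeal K m) w) k l := by
  rcases lt_trichotomy k l with h | rfl | h
  · rw [plucker_of_lt h, symCoord, dif_pos h]; rfl
  · simp [plucker_self, symCoord, hw.map_zero]
  · rw [plucker_swap, hw.map_neg, plucker_of_lt h, symCoord, dif_neg h.not_gt, dif_pos h]; rfl

/-- The smallest coordinate involving the index `k`. -/
noncomputable def rowMin {m : ℕ} (ξ : GrVar m → RInf) (k : Fin m) : RInf :=
  Finset.univ.inf fun j => symCoord ξ j k

lemma continuous_rowMin (k : Fin m) : Continuous fun ξ : GrVar m → RInf => rowMin ξ k :=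
  Continuous.finset_inf_apply fun _ _ => continuous_symCoord _ _

end Plucker

section TreeValuation

variable {K : Type*} [Field K] {m : ℕ}

/-- The linear form `Σ_{j ∈ M k} e_j`. -/
noncomputable def branchForm (K : Type*) [Field K] {m : ℕ} (M : Fin m → Finset (Fin m))
    (k : Fin m) : MvPolynomial (Fin m ⊕ Fin m) K :=
  ∑ j ∈ M k, MvPolynomial.X (Sum.inr j)

/-- The homomorphism `x_{kl} ↦ t_k t_l (u_l - u_k)`, where `u_k = Σ_{j ∈ M k} e_j`. -/
noncomputable def treeHom (K : Type*) [Field K] {m : ℕ} (M : Fin m → Finset (Fin m)) :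
    MvPolynomial (GrVar m) K →ₐ[K] MvPolynomial (Fin m ⊕ Fin m) K :=
  MvPolynomial.aeval fun e : GrVar m =>
    MvPolynomial.X (Sum.inl e.val.1) * MvPolynomial.X (Sum.inl e.val.2)
      * (branchForm K M e.val.2 - branchForm K M e.val.1)

lemma treeHom_eq_zero (M : Fin m → Finset (Fin m)) {F : MvPolynomial (GrVar m) K}
    (hF : F ∈ grIdeal K m) : treeHom K M F = 0 := by
  have : treeHom K M = (MvPolynomial.aeval (Sum.elim
      (fun k => (MvPolynomial.X (Sum.inl k) : MvPolynomial (Fin m ⊕ Fin m) K))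
      fun k => MvPolynomial.X (Sum.inl k) * branchForm K M k)).comp (minorHom K m) := by
    apply MvPolynomial.algHom_ext
    intro e
    simp [treeHom, minorHom]
    ring
  rw [this, AlgHom.comp_apply, mem_grIdeal.mp hF, map_zero]

lemma treeHom_pluckerVar (M : Fin m → Finset (Fin m)) (k l : Fin m) :
    treeHom K M (pluckerVar K k l)
      = MvPolynomial.X (Sum.inl k) * MvPolynomial.X (Sum.inl l)
        * (branchForm K M l - branchForm K M k) := by
  unfold pluckerVar
  split_ifs with h h'
  · simp [treeHom]
  · simp [treeHom]; ring
  · obtain rfl : k = l := le_antisymm (not_lt.mp h') (not_lt.mp h)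
    simp

/-- The valuation on the coordinate ring induced by the monomial valuation with `t_k ↦ τ_k`
and `e_j ↦ δ_j` through `treeHom`. -/
noncomputable def treeVal (v : K → RInf) (M : Fin m → Finset (Fin m)) (τ δ : Fin m → RInf) :
    (MvPolynomial (GrVar m) K ⧸ grIdeal K m) → RInf := fun f =>
  gauss v (Sum.elim τ δ) (Ideal.Quotient.lift (grIdeal K m) (treeHom K M : _ →+* _)
    (fun _ h => treeHom_eq_zero M h) f)

lemma treeVal_mk (v : K → RInf) (M : Fin m → Finset (Fin m)) (τ δ : Fin m → RInf)
    (F : MvPolynomial (GrVar m) K) :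
    treeVal v M τ δ (Ideal.Quotient.mk _ F) = gauss v (Sum.elim τ δ) (treeHom K M F) :=
  rfl

variable {v : K → RInf}

lemma treeVal_mem_An (hv : IsVal v) (M : Fin m → Finset (Fin m)) (τ δ : Fin m → RInf) :
    treeVal v M τ δ ∈ An v (MvPolynomial (GrVar m) K ⧸ grIdeal K m) := by
  refine ⟨(gauss_isVal hv (Sum.elim τ δ)).comp _, fun c => ?_⟩
  have : algebraMap K (MvPolynomial (GrVar m) K ⧸ grIdeal K m) c
      = Ideal.Quotient.mk _ (MvPolynomial.C c) := rfl
  rw [this, treeVal_mk, ← MvPolynomial.algebraMap_eq, AlgHom.commutes,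
    MvPolynomial.algebraMap_eq, gauss_C hv]

lemma coeff_branchForm (M : Fin m → Finset (Fin m)) (k j : Fin m) :
    (branchForm K M k).coeff (Finsupp.single (Sum.inr j) 1) = if j ∈ M k then 1 else 0 := by
  rw [branchForm, MvPolynomial.coeff_sum]
  simp [MvPolynomial.coeff_X, Finsupp.single_left_inj]

lemma gauss_branchForm_sub (hv : IsVal v) (M : Fin m → Finset (Fin m)) (τ δ : Fin m → RInf)
    (k l : Fin m) : gauss v (Sum.elim τ δ) (branchForm K M l - branchForm K M k)
      = (symmDiff (M k) (M l)).inf δ := by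
  have hG := gauss_isVal hv (Sum.elim τ δ)
  apply le_antisymm
  · refine Finset.le_inf fun j hj => ?_
    refine (gauss_le hv _ _ (Finsupp.single (Sum.inr j) 1)).trans ?_
    rw [MvPolynomial.coeff_sub, coeff_branchForm, coeff_branchForm]
    rcases Finset.mem_symmDiff.mp hj with ⟨h1, h2⟩ | ⟨h1, h2⟩
    · simp [h1, h2, hv.map_neg_one]
    · simp [h1, h2, hv.map_one]
  · have : branchForm K M l - branchForm K M k
        = ∑ j ∈ M l \ M k, MvPolynomial.X (Sum.inr j)
          - ∑ j ∈ M k \ M l, MvPolynomial.X (Sum.inr j) := by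
      rw [branchForm, branchForm, Finset.sum_sdiff_sub_sum_sdiff]
    rw [this]
    refine le_trans (le_min ?_ ?_) (hG.min_le_sub _ _) <;>
    · refine hG.le_sum _ _ fun j hj => ?_
      rw [gauss_X hv]
      refine Finset.inf_le (f := δ) ?_
      rw [Finset.mem_symmDiff]
      simp only [Finset.mem_sdiff] at hj
      tauto

lemma treeVal_plucker (hv : IsVal v) (M : Fin m → Finset (Fin m)) (τ δ : Fin m → RInf)
    (k l : Fin m) :
    treeVal v M τ δ (plucker K k l) = τ k + τ l + (symmDiff (M k) (M l)).inf δ := by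
  have hG := gauss_isVal hv (Sum.elim τ δ)
  rw [plucker, treeVal_mk, treeHom_pluckerVar, hG.map_mul, hG.map_mul, gauss_X hv, gauss_X hv,
    gauss_branchForm_sub hv]
  rfl

lemma tropMap_treeVal (hv : IsVal v) (M : Fin m → Finset (Fin m)) (τ δ : Fin m → RInf)
    (e : GrVar m) : tropMap (grIdeal K m) (treeVal v M τ δ) e
      = τ e.val.1 + τ e.val.2 + (symmDiff (M e.val.1) (M e.val.2)).inf δ := by
  rw [← treeVal_plucker hv, plucker_of_lt e.prop]
  rfl

lemma continuous_treeVal (v : K → RInf) (M : Fin m → Finset (Fin m))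
    (f : MvPolynomial (GrVar m) K ⧸ grIdeal K m) :
    Continuous fun p : (Fin m → RInf) × (Fin m → RInf) => treeVal v M p.1 p.2 f := by
  refine (continuous_gauss v _).comp (continuous_pi fun i => ?_)
  rcases i with i | i
  · exact (continuous_apply i).comp continuous_fst
  · exact (continuous_apply i).comp continuous_snd

/-- The weights of `t_k` and `e_j` matching the weights of the Plücker coordinates. -/
noncomputable def treeWt (m : ℕ) : Fin m ⊕ Fin m → Fin m → ℤ :=
  Sum.elim (fun i => Pi.single i 1) 0

lemma treeHom_wtComp (M : Fin m → Finset (Fin m)) (F : MvPolynomial (GrVar m) K)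
    (β : Fin m → ℤ) :
    treeHom K M (wtComp (grWt m) F β) = wtComp (treeWt m) (treeHom K M F) β := by
  refine map_wtComp _ _ _ (fun e => ?_) F β
  have hb : ∀ k, MvPolynomial.IsWeightedHomogeneous (treeWt m) (branchForm K M k) 0 :=
    fun k => MvPolynomial.IsWeightedHomogeneous.sum _ _ _ fun j _ =>
      MvPolynomial.isWeightedHomogeneous_X K (treeWt m) (Sum.inr j)
  rw [treeHom, MvPolynomial.aeval_X, grWt, ← add_zero (_ + _)]
  exact ((MvPolynomial.isWeightedHomogeneous_X K (treeWt m) (Sum.inl e.val.1)).mul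
    (MvPolynomial.isWeightedHomogeneous_X K (treeWt m) (Sum.inl e.val.2))).mul
      ((hb _).sub (hb _))

lemma monomial_weight_shift (τ δ : Fin m → RInf) (s : Fin m → ℝ)
    (α : Fin m ⊕ Fin m →₀ ℕ) :
    (α.sum fun i k => k • Sum.elim (fun j => τ j + (s j : RInf)) δ i)
      = (α.sum fun i k => k • Sum.elim τ δ i)
        + ((pairR (wt (treeWt m) α) s : ℝ) : RInf) := by
  rw [Finsupp.sum_fintype α (fun i k => k • _) (fun _ => zero_nsmul _),
    Finsupp.sum_fintype α (fun i k => k • _) (fun _ => zero_nsmul _),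
    Fintype.sum_sum_type, Fintype.sum_sum_type]
  have : pairR (wt (treeWt m) α) s = ∑ j, (α (Sum.inl j) : ℝ) * s j := by
    unfold pairR
    refine Finset.sum_congr rfl fun j _ => ?_
    congr 1
    rw [wt, Finsupp.sum_fintype _ _ (by simp), Fintype.sum_sum_type]
    simp [treeWt, Finset.sum_apply, Pi.single_apply]
  rw [this]
  simp only [Sum.elim_inl, Sum.elim_inr, nsmul_add, Finset.sum_add_distrib]
  have hs : ((∑ j, (α (Sum.inl j) : ℝ) * s j : ℝ) : RInf)
      = ∑ j, α (Sum.inl j) • ((s j : ℝ) : RInf) := by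
    rw [WithTop.coe_sum]
    refine Finset.sum_congr rfl fun j _ => ?_
    rw [← WithTop.coe_nsmul, nsmul_eq_mul]
  rw [hs]
  abel

lemma mu_treeVal (hv : IsVal v) (M : Fin m → Finset (Fin m)) (τ δ : Fin m → RInf)
    (s : Fin m → ℝ) :
    mu (grWt m) (grIdeal K m) s (treeVal v M τ δ)
      = treeVal v M (fun j => τ j + (s j : RInf)) δ := by
  funext f
  obtain ⟨F, hF⟩ : ∃ F, F = Function.surjInv Ideal.Quotient.mk_surjective f := ⟨_, rfl⟩
  have hf : f = Ideal.Quotient.mk (grIdeal K m) F := by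
    rw [hF, Function.surjInv_eq Ideal.Quotient.mk_surjective f]
  rw [mu, ← hF, hf, treeVal_mk, muAux]
  simp only [treeVal_mk, treeHom_wtComp]
  set H := treeHom K M F with hH
  have hcoeff : ∀ α β, (wtComp (treeWt m) H β).coeff α
      = if wt (treeWt m) α = β then H.coeff α else 0 := by
    intro α β
    rw [wtComp_eq_component, MvPolynomial.coeff_weightedHomogeneousComponent, wt_eq_weight]
  apply le_antisymm
  · refine le_gauss fun α hα => ?_
    rw [monomial_weight_shift, ← add_assoc]
    have hmem : wt (treeWt m) α ∈ F.support.image (wt (grWt m)) := by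
      by_contra hn
      have h0 : wtComp (grWt m) F (wt (treeWt m) α) = 0 := by
        refine Finset.sum_eq_zero fun γ hγ => absurd ?_ hn
        rw [Finset.mem_filter] at hγ
        exact Finset.mem_image.mpr ⟨γ, hγ⟩
      have h1 := hcoeff α (wt (treeWt m) α)
      rw [hH, ← treeHom_wtComp, h0, map_zero, MvPolynomial.coeff_zero, if_pos rfl] at h1
      exact MvPolynomial.mem_support_iff.mp hα h1.symm
    refine (Finset.inf_le hmem).trans (add_le_add ?_ le_rfl)
    refine (gauss_le hv _ _ α).trans ?_
    rw [hcoeff, if_pos rfl]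
  · refine Finset.le_inf fun β _ => ?_
    rw [← RInf.add_neg_coe_le_iff]
    refine le_gauss fun α hα => ?_
    rw [MvPolynomial.mem_support_iff, hcoeff] at hα
    have hβ : wt (treeWt m) α = β := by by_contra h; simp [h] at hα
    rw [RInf.add_neg_coe_le_iff, hcoeff, if_pos hβ]
    refine (gauss_le hv _ _ α).trans ?_
    rw [monomial_weight_shift, ← add_assoc, hβ]

lemma mu_mono (s : Fin m → ℝ) {w w' : (MvPolynomial (GrVar m) K ⧸ grIdeal K m) → RInf}
    (h : w ≤ w') : mu (grWt m) (grIdeal K m) s w ≤ mu (grWt m) (grIdeal K m) s w' :=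
  fun _ => Finset.inf_mono_fun fun _ _ => add_le_add (h _) le_rfl

end TreeValuation

section TreeData

variable {K : Type*} [Field K] {m : ℕ}

lemma IsVal.eq_top_iff {κ : Type*} [Field κ] {w : κ → RInf} (hw : IsVal w) {x : κ} :
    w x = ⊤ ↔ x = 0 := by
  refine ⟨fun h => ?_, fun h => h ▸ hw.map_zero⟩
  by_contra hx
  have := hw.map_mul x x⁻¹
  rw [mul_inv_cancel₀ hx, hw.map_one, h, top_add] at this
  exact WithTop.zero_ne_top this

lemma gauss_linear {R σ : Type*} [CommRing R] [Fintype σ] {v : R → RInf} (hv : IsVal v)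
    (c : σ → R) :
    gauss v (fun _ => 0) (∑ j, MvPolynomial.C (c j) * MvPolynomial.X j)
      = Finset.univ.inf fun j => v (c j) := by
  have hG := gauss_isVal hv (fun _ : σ => (0 : RInf))
  apply le_antisymm
  · refine Finset.le_inf fun j _ => ?_
    refine (gauss_le hv _ _ (Finsupp.single j 1)).trans ?_
    simp [MvPolynomial.coeff_sum, MvPolynomial.coeff_C_mul, MvPolynomial.coeff_X,
      Finsupp.single_left_inj, Finsupp.sum]
  · refine hG.le_sum _ _ fun j hj => ?_
    rw [hG.map_mul, gauss_C hv, gauss_X hv, add_zero]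
    exact Finset.inf_le (f := fun j => v (c j)) hj

/-- Over a valued extension field, the Plücker coordinates of a point become
`y_k y_l (u_l - u_k)`, with the valuation of `y_k` as small as possible. -/
lemma IsVal.exists_uniformization.{u} {K : Type u} [Field K]
    {w : (MvPolynomial (GrVar m) K ⧸ grIdeal K m) → RInf} (hw : IsVal w) {r : Fin m}
    (hr : ∀ k, rowMin (tropMap (grIdeal K m) w) r ≤ rowMin (tropMap (grIdeal K m) w) k) :
    ∃ (κ : Type u) (_ : Field κ) (φ : (MvPolynomial (GrVar m) K ⧸ grIdeal K m) →+* κ)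
      (w' : κ → RInf) (y u : Fin m → κ), IsVal w' ∧ (∀ x, w' (φ x) = w x) ∧
      (∀ k, w' (y k) = rowMin (tropMap (grIdeal K m) w) k) ∧
      (∀ k l, y k * y l * (u l - u k) = φ (plucker K k l)) ∧ u r = 0 ∧
      ∀ k, y k = 0 → u k = 0 := by
  set ξ := tropMap (grIdeal K m) w with hξ
  let Y : Fin m → MvPolynomial (Fin m) (MvPolynomial (GrVar m) K ⧸ grIdeal K m) := fun k =>
    ∑ j, MvPolynomial.C (plucker K j k) * MvPolynomial.X j
  obtain ⟨κ, _, f, w', hw', hf⟩ := (gauss_isVal hw (fun _ : Fin m => (0 : RInf))).exists_field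
  have hval : ∀ x, w' (f (MvPolynomial.C x)) = w x := fun x => by rw [hf, gauss_C hw]
  have hY : ∀ k, w' (f (Y k)) = rowMin ξ k := fun k => by
    rw [hf, gauss_linear hw]
    simp only [hw.plucker_eq_symCoord, ← hξ, rowMin]
  have hrel : ∀ k l, f (Y r) * f (MvPolynomial.C (plucker K k l))
      = f (Y k) * f (MvPolynomial.C (plucker K r l))
        - f (Y l) * f (MvPolynomial.C (plucker K r k)) := fun k l => by
    simp only [← _root_.map_mul, ← map_sub]
    refine congrArg f ?_
    simp only [Y, Finset.sum_mul, ← Finset.sum_sub_distrib]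
    refine Finset.sum_congr rfl fun j _ => ?_
    have h := congrArg (MvPolynomial.C (σ := Fin m)) (plucker_relation (K := K) j r k l)
    simp only [map_add, map_sub, _root_.map_mul, _root_.map_zero] at h
    linear_combination MvPolynomial.X j * h
  have hzero : ∀ k l, f (Y k) = 0 → f (MvPolynomial.C (plucker K k l)) = 0 := fun k l h => by
    rw [← hw'.eq_top_iff, hval, ← neg_neg (plucker K k l), ← plucker_swap, hw.map_neg,
      hw.plucker_eq_symCoord, ← hξ, ← top_le_iff, ← hw'.eq_top_iff.mpr h, hY]
    exact Finset.inf_le (f := fun j => symCoord ξ j k) (Finset.mem_univ l)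
  have hzero' : ∀ k l, f (Y l) = 0 → f (MvPolynomial.C (plucker K k l)) = 0 := fun k l h => by
    rw [plucker_swap, _root_.map_neg, _root_.map_neg, hzero l k h, neg_zero]
  have hroot : ∀ k, f (Y k) ≠ 0 → f (Y r) ≠ 0 := fun k hk h => hk <| by
    rw [← hw'.eq_top_iff, ← top_le_iff, ← hw'.eq_top_iff.mpr h, hY, hY]
    exact hr k
  refine ⟨κ, inferInstance, f.comp MvPolynomial.C, w', fun k => f (Y k),
    fun k => f (MvPolynomial.C (plucker K r k)) / (f (Y r) * f (Y k)), hw', hval, hY,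
    fun k l => ?_, by simp [plucker_self], fun k hk => by simp [hk]⟩
  change f (Y k) * f (Y l) * _ = f (MvPolynomial.C (plucker K k l))
  by_cases hk : f (Y k) = 0
  · rw [hzero k l hk, hk, zero_mul, zero_mul]
  by_cases hl : f (Y l) = 0
  · rw [hzero' k l hl, hl, mul_zero, zero_mul]
  have h0 := hroot k hk
  have := hrel k l
  field_simp
  linear_combination -this

/-- Combinatorial data describing a point of the tropical Grassmannian: a rooted tree on the
indices with parent map `p` and root `r`, the sets `M k` of vertices on the path from `k` to
the root (without the root), and edge lengths `δ`. -/
structure IsTreeDatum (ξ : GrVar m → RInf) (M : Fin m → Finset (Fin m)) (p : Fin m → Fin m)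
    (r : Fin m) (δ : Fin m → RInf) : Prop where
  root_le : ∀ k, rowMin ξ r ≤ rowMin ξ k
  root_eq : M r = ∅
  parent_le : ∀ k, k ≠ r → rowMin ξ (p k) ≤ rowMin ξ k
  notMem : ∀ k, k ≠ r → k ∉ M (p k)
  eq_insert : ∀ k, k ≠ r → M k = insert k (M (p k))
  symCoord_eq : ∀ k l, k ≠ l →
    rowMin ξ k + rowMin ξ l + (symmDiff (M k) (M l)).inf δ = symCoord ξ k l

namespace IsTreeDatum

variable {ξ : GrVar m → RInf} {M : Fin m → Finset (Fin m)} {p : Fin m → Fin m} {r : Fin m}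
  {δ : Fin m → RInf} {v : K → RInf}

lemma tropMap_treeVal_eq (h : IsTreeDatum ξ M p r δ) (hv : IsVal v) :
    tropMap (grIdeal K m) (treeVal v M (rowMin ξ) δ) = ξ := by
  funext e
  rw [tropMap_treeVal hv, h.symCoord_eq _ _ e.prop.ne, symCoord, dif_pos e.prop]

lemma length_eq (h : IsTreeDatum ξ M p r δ) {k : Fin m} (hk : k ≠ r) :
    rowMin ξ k + rowMin ξ (p k) + δ k = symCoord ξ k (p k) := by
  have hne : k ≠ p k := fun he => h.notMem k hk <| by
    rw [← he, h.eq_insert k hk]; exact Finset.mem_insert_self _ _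
  rw [← h.symCoord_eq k (p k) hne]
  congr 1
  have : symmDiff (M k) (M (p k)) = {k} := by
    ext j
    have := h.notMem k hk
    rw [h.eq_insert k hk, Finset.mem_symmDiff, Finset.mem_insert, Finset.mem_singleton]
    constructor
    · tauto
    · rintro rfl; tauto
  rw [this, Finset.inf_singleton]

/-- The tree valuation is the smallest valuation with the given tropicalization. -/
lemma treeVal_le (h : IsTreeDatum ξ M p r δ)
    {w : (MvPolynomial (GrVar m) K ⧸ grIdeal K m) → RInf}
    (hw : w ∈ An v (MvPolynomial (GrVar m) K ⧸ grIdeal K m))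
    (hξ : tropMap (grIdeal K m) w = ξ) : treeVal v M (rowMin ξ) δ ≤ w := by
  subst hξ
  obtain ⟨κ, _, φ, w', y, u, hw', hφ, hy, hP, hu, -⟩ := hw.1.exists_uniformization h.root_le
  have hy0 : ∀ k, k ≠ r → y k ≠ 0 → y (p k) ≠ 0 := fun k hk hyk h0 => hyk <| by
    rw [← hw'.eq_top_iff, ← top_le_iff, ← hw'.eq_top_iff.mpr h0, hy, hy]
    exact h.parent_le k hk
  let E : Fin m → κ := fun k => if y k = 0 ∨ k = r then 0 else u k - u (p k)
  have hsum : ∀ n k, (M k).card = n → y k ≠ 0 → ∑ j ∈ M k, E j = u k := by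
    intro n
    induction n with
    | zero =>
      intro k hc _
      have hk : k = r := by
        by_contra hk
        rw [Finset.card_eq_zero, h.eq_insert k hk] at hc
        exact Finset.insert_ne_empty _ _ hc
      rw [hk, h.root_eq, hu, Finset.sum_empty]
    | succ n ih =>
      intro k hc hk0
      have hk : k ≠ r := by
        rintro rfl
        rw [h.root_eq] at hc
        simp at hc
      rw [h.eq_insert k hk, Finset.card_insert_of_notMem (h.notMem k hk)] at hc
      rw [h.eq_insert k hk, Finset.sum_insert (h.notMem k hk),
        ih (p k) (by omega) (hy0 k hk hk0)]
      simp [E, hk, hk0]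
  let ψ := MvPolynomial.eval₂Hom (φ.comp (algebraMap K _)) (Sum.elim y E)
  have hψ : ∀ F, ψ (treeHom K M F) = φ (Ideal.Quotient.mk _ F) := by
    intro F
    have : ψ.comp (treeHom K M : MvPolynomial (GrVar m) K →+* _)
        = φ.comp (Ideal.Quotient.mk (grIdeal K m)) := by
      apply MvPolynomial.ringHom_ext
      · intro c
        have hc : treeHom K M (MvPolynomial.C c) = MvPolynomial.C c :=
          (treeHom K M).commutes c
        simp only [RingHom.comp_apply, RingHom.coe_coe, hc, ψ, MvPolynomial.eval₂Hom_C]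
        rfl
      · intro e
        have hlin : ∀ k, y k ≠ 0 → ψ (branchForm K M k) = u k := fun k hk => by
          rw [branchForm, map_sum, ← hsum _ k rfl hk]
          exact Finset.sum_congr rfl fun j _ => by simp [ψ]
        simp only [RingHom.comp_apply, RingHom.coe_coe]
        rw [← plucker_of_lt e.prop, ← hP]
        simp only [treeHom, MvPolynomial.aeval_X, map_mul, map_sub]
        have hX : ∀ k, ψ (MvPolynomial.X (Sum.inl k)) = y k := fun k => by simp [ψ]
        rw [hX, hX]
        by_cases h1 : y e.val.1 = 0
        · simp [h1]
        by_cases h2 : y e.val.2 = 0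
        · simp [h2]
        rw [hlin _ h1, hlin _ h2]
    exact congrArg (fun g => g F) this
  intro f
  obtain ⟨F, rfl⟩ := Ideal.Quotient.mk_surjective f
  rw [treeVal_mk, ← hφ, ← hψ]
  refine le_gauss_of_isVal hw' _ _ (fun c => ?_) ?_ _
  · rw [RingHom.comp_apply, hφ, hw.2]
  · rintro (k | k)
    · exact (hy k).symm.le
    · change δ k ≤ w' (E k)
      by_cases hk : y k = 0 ∨ k = r
      · simp [E, hk, hw'.map_zero]
      · rw [not_or] at hk
        have hk' : w' (y k * y (p k)) ≠ ⊤ := by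
          rw [Ne, hw'.eq_top_iff]
          exact mul_ne_zero hk.1 (hy0 k hk.2 hk.1)
        have hlen := h.length_eq hk.2
        rw [← hw.1.plucker_eq_symCoord, ← hφ, ← hP, hw'.map_mul, ← hy, ← hy, ← hw'.map_mul,
          WithTop.add_left_inj hk'] at hlen
        rw [hlen, ← hw'.map_neg]
        simp [E, hk]

end IsTreeDatum

end TreeData

/-- A finite ultrametric space whose points carry heights is the path-minimum distance of a
rooted tree along which heights decrease towards the root. -/
lemma exists_rooted_tree {ι α β : Type*} [DecidableEq ι] [LinearOrder α] [OrderTop α]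
    [LinearOrder β] {d : ι → ι → α} (h_self : ∀ a, d a a = ⊤) (h_symm : ∀ a b, d a b = d b a)
    (h_ultra : ∀ a b c, min (d a b) (d b c) ≤ d a c) (τ : ι → β) (S : Finset ι)
    (hS : S.Nonempty) :
    ∃ (M : ι → Finset ι) (p : ι → ι) (r : ι), r ∈ S ∧ M r = ∅ ∧ (∀ k ∈ S, τ r ≤ τ k) ∧
      (∀ k ∈ S, M k ⊆ S) ∧
      (∀ k ∈ S, k ≠ r → p k ∈ S ∧ τ (p k) ≤ τ k ∧ k ∉ M (p k) ∧ M k = insert k (M (p k))) ∧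
      ∀ k ∈ S, ∀ l ∈ S, ((symmDiff (M k) (M l)).inf fun j => d j (p j)) = d k l := by
  induction S using Finset.induction_on_max_value τ with
  | empty => exact absurd hS Finset.not_nonempty_empty
  | insert a s ha hmax ih =>
    rcases s.eq_empty_or_nonempty with rfl | hs
    · refine ⟨fun _ => ∅, id, a, by simp, rfl, ?_, ?_, ?_, ?_⟩ <;> simp [h_self]
    obtain ⟨M, p, r, hr, hMr, hτ, hsub, hp, hd⟩ := ih hs
    obtain ⟨q, hq, hqmax⟩ := s.exists_max_image (d a) hs
    have hne : ∀ k ∈ s, k ≠ a := fun k hk h => ha (h ▸ hk)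
    have haM : ∀ k ∈ s, a ∉ M k := fun k hk h => ha (hsub k hk h)
    have hM : ∀ k ∈ s, Function.update M a (insert a (M q)) k = M k :=
      fun k hk => Function.update_of_ne (hne k hk) _ _
    have hpk : ∀ k ∈ s, Function.update p a q k = p k :=
      fun k hk => Function.update_of_ne (hne k hk) _ _
    have hinf : ∀ k ∈ s, ∀ l ∈ s, ((symmDiff (M k) (M l)).inf fun j =>
        d j (Function.update p a q j)) = d k l := fun k hk l hl => by
      rw [← hd k hk l hl]
      refine Finset.inf_congr rfl fun j hj => ?_
      have : j ∈ s := by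
        rcases Finset.mem_symmDiff.mp hj with h | h
        · exact hsub k hk h.1
        · exact hsub l hl h.1
      rw [hpk j this]
    have hda : ∀ l ∈ s, ((symmDiff (insert a (M q)) (M l)).inf fun j =>
        d j (Function.update p a q j)) = d a l := fun l hl => by
      have : symmDiff (insert a (M q)) (M l) = insert a (symmDiff (M q) (M l)) := by
        ext j
        have h1 := haM q hq
        have h2 := haM l hl
        simp only [Finset.mem_symmDiff, Finset.mem_insert]
        by_cases hj : j = a
        · subst hj; tauto
        · tauto
      rw [this, Finset.inf_insert, hinf q hq l hl, Function.update_self]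
      refine le_antisymm (h_ultra a q l) (le_min (hqmax l hl) ?_)
      have := h_ultra q a l
      rwa [h_symm q a, min_eq_right (hqmax l hl)] at this
    refine ⟨Function.update M a (insert a (M q)), Function.update p a q, r,
      Finset.mem_insert_of_mem hr, by rw [hM r hr, hMr], ?_, ?_, ?_, ?_⟩
    · intro k hk
      rcases Finset.mem_insert.mp hk with rfl | hk
      · exact hmax r hr
      · exact hτ k hk
    · intro k hk
      rcases Finset.mem_insert.mp hk with rfl | hk
      · rw [Function.update_self]
        exact Finset.insert_subset_insert _ (hsub q hq)
      · rw [hM k hk]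
        exact (hsub k hk).trans (Finset.subset_insert _ _)
    · intro k hk hkr
      rcases Finset.mem_insert.mp hk with rfl | hk
      · rw [Function.update_self, Function.update_self, hM q hq]
        exact ⟨Finset.mem_insert_of_mem hq, hmax q hq, haM q hq, rfl⟩
      · obtain ⟨h1, h2⟩ := hp k hk hkr
        rw [hpk k hk, hM k hk, hM _ h1]
        exact ⟨Finset.mem_insert_of_mem h1, h2⟩
    · intro k hk l hl
      rcases Finset.mem_insert.mp hk with rfl | hks <;>
        rcases Finset.mem_insert.mp hl with rfl | hls
      · rw [symmDiff_self, h_self]; rfl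
      · rw [hM l hls, Function.update_self]
        exact hda l hls
      · rw [hM k hks, Function.update_self, symmDiff_comm, h_symm]
        exact hda k hks
      · rw [hM k hks, hM l hls]
        exact hinf k hks l hls

section Existence

variable {K : Type*} [Field K] {m : ℕ} {v : K → RInf}

lemma exists_isTreeDatum [NeZero m] {ξ : GrVar m → RInf} (hξ : ξ ∈ TropSet v (grIdeal K m)) :
    ∃ (M : Fin m → Finset (Fin m)) (p : Fin m → Fin m) (r : Fin m) (δ : Fin m → RInf),
      IsTreeDatum ξ M p r δ ∧ ∀ j a b, 0 ≤ δ j + symCoord ξ a b := by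
  obtain ⟨w, hw, rfl⟩ := hξ
  set ξ := tropMap (grIdeal K m) w with hξ
  obtain ⟨r₀, -, hr₀⟩ := Finset.univ.exists_min_image (rowMin ξ) Finset.univ_nonempty
  have hr₀' : ∀ k, rowMin ξ r₀ ≤ rowMin ξ k := fun k => hr₀ k (Finset.mem_univ k)
  obtain ⟨κ, _, φ, w', y, u, hw', hφ, hy, hP, hu, hyu⟩ := hw.1.exists_uniformization hr₀'
  obtain ⟨M, p, r, -, hMr, hτ, -, hp, hd⟩ := exists_rooted_tree (d := fun a b => w' (u a - u b))
    (fun a => by rw [sub_self, hw'.map_zero])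
    (fun a b => by rw [← neg_sub, hw'.map_neg])
    (fun a b c => by simpa using hw'.min_le_add (u a - u b) (u b - u c))
    (rowMin ξ) Finset.univ Finset.univ_nonempty
  refine ⟨M, p, r, fun j => w' (u j - u (p j)),
    ⟨fun k => hτ k (Finset.mem_univ k), hMr, fun k hk => (hp k (Finset.mem_univ k) hk).2.1,
      fun k hk => (hp k (Finset.mem_univ k) hk).2.2.1,
      fun k hk => (hp k (Finset.mem_univ k) hk).2.2.2, fun k l _ => ?_⟩, fun j a b => ?_⟩
  · rw [hd k (Finset.mem_univ k) l (Finset.mem_univ l), ← hy, ← hy, ← hw'.map_neg (u k - u l),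
      neg_sub, ← hw'.map_mul, ← hw'.map_mul, hP, hφ, hw.1.plucker_eq_symCoord]
  · change 0 ≤ w' (u j - u (p j)) + symCoord ξ a b
    have hτP : ∀ k l, w' (y k) ≤ w' (φ (plucker K k l)) := fun k l => by
      rw [hy, hφ, ← neg_neg (plucker K k l), ← plucker_swap, hw.1.map_neg,
        hw.1.plucker_eq_symCoord]
      exact Finset.inf_le (f := fun j => symCoord ξ j k) (Finset.mem_univ l)
    have key : ∀ k l, y k ≠ 0 → y l ≠ 0 → 0 ≤ w' (u l - u k) + symCoord ξ a b := by
      intro k l hk hl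
      have hkl : w' (y k * y l) ≠ ⊤ := by
        rw [Ne, hw'.eq_top_iff]
        exact mul_ne_zero hk hl
      rw [← WithTop.add_le_add_iff_left hkl, add_zero, ← add_assoc, ← hw'.map_mul, hP,
        ← hw.1.plucker_eq_symCoord, ← hφ, ← hw'.map_mul, ← map_mul]
      have hrel : plucker K k l * plucker K a b
          = plucker K k a * plucker K l b - plucker K k b * plucker K l a := by
        linear_combination plucker_relation (K := K) k l a b
      rw [hrel, map_sub]
      refine le_trans (le_min ?_ ?_) (hw'.min_le_sub _ _) <;>
      · rw [map_mul, hw'.map_mul, hw'.map_mul]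
        exact add_le_add (hτP _ _) (hτP _ _)
    by_cases h0 : y r₀ = 0
    · have : ∀ k, u k = 0 := fun k => hyu k <| by
        rw [← hw'.eq_top_iff, ← top_le_iff, ← hw'.eq_top_iff.mpr h0, hy, hy]
        exact hr₀' k
      simp [this, hw'.map_zero]
    · have hex : ∀ k, ∃ k', y k' ≠ 0 ∧ u k' = u k := fun k => by
        by_cases hk : y k = 0
        · exact ⟨r₀, h0, by rw [hu, hyu k hk]⟩
        · exact ⟨k, hk, rfl⟩
      obtain ⟨k, hk, hku⟩ := hex (p j)
      obtain ⟨l, hl, hlu⟩ := hex j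
      rw [← hku, ← hlu]
      exact key k l hk hl

end Existence

section Equivariance

variable {K : Type*} [Field K] {m : ℕ} {v : K → RInf}

lemma IsTreeDatum.treeVal_unique {ξ : GrVar m → RInf} {M M' : Fin m → Finset (Fin m)}
    {p p' : Fin m → Fin m} {r r' : Fin m} {δ δ' : Fin m → RInf} (hv : IsVal v)
    (h : IsTreeDatum ξ M p r δ) (h' : IsTreeDatum ξ M' p' r' δ') :
    treeVal v M (rowMin ξ) δ = treeVal v M' (rowMin ξ) δ' :=
  le_antisymm (h.treeVal_le (treeVal_mem_An hv _ _ _) (h'.tropMap_treeVal_eq hv))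
    (h'.treeVal_le (treeVal_mem_An hv _ _ _) (h.tropMap_treeVal_eq hv))

lemma tropMap_treeVal_shift (hv : IsVal v) (M : Fin m → Finset (Fin m)) (τ δ : Fin m → RInf)
    (s : Fin m → ℝ) :
    tropMap (grIdeal K m) (treeVal v M (fun j => τ j + (s j : RInf)) δ)
      = fun e => tropMap (grIdeal K m) (treeVal v M τ δ) e
          + ((s e.val.1 + s e.val.2 : ℝ) : RInf) := by
  funext e
  rw [tropMap_treeVal hv, tropMap_treeVal hv, WithTop.coe_add]
  abel

lemma IsTreeDatum.treeVal_shift {ξ : GrVar m → RInf} {M M' : Fin m → Finset (Fin m)}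
    {p p' : Fin m → Fin m} {r r' : Fin m} {δ δ' : Fin m → RInf} (hv : IsVal v) (s : Fin m → ℝ)
    (h : IsTreeDatum ξ M p r δ)
    (h' : IsTreeDatum (fun e => ξ e + ((s e.val.1 + s e.val.2 : ℝ) : RInf)) M' p' r' δ') :
    treeVal v M' (rowMin fun e => ξ e + ((s e.val.1 + s e.val.2 : ℝ) : RInf)) δ'
      = mu (grWt m) (grIdeal K m) s (treeVal v M (rowMin ξ) δ) := by
  set ξ' : GrVar m → RInf := fun e => ξ e + ((s e.val.1 + s e.val.2 : ℝ) : RInf) with hξ'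
  have cancel : ∀ (t : ℝ) (x : RInf), x + (t : RInf) + ((-t : ℝ) : RInf) = x := fun t x => by
    rw [add_assoc, ← WithTop.coe_add, add_neg_cancel, WithTop.coe_zero, add_zero]
  apply le_antisymm
  · rw [mu_treeVal hv]
    refine h'.treeVal_le (treeVal_mem_An hv _ _ _) ?_
    rw [tropMap_treeVal_shift hv, h.tropMap_treeVal_eq hv]
  · have hle : treeVal v M (rowMin ξ) δ
        ≤ treeVal v M' (fun j => rowMin ξ' j + ((-s j : ℝ) : RInf)) δ' := by
      refine h.treeVal_le (treeVal_mem_An hv _ _ _) ?_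
      rw [tropMap_treeVal_shift hv M' (rowMin ξ') δ' (fun j => -s j),
        h'.tropMap_treeVal_eq hv]
      funext e
      rw [hξ', ← neg_add]
      exact cancel _ _
    refine (mu_mono s hle).trans ?_
    rw [mu_treeVal hv]
    refine le_of_eq (congrArg (fun τ => treeVal v M' τ δ') (funext fun j => ?_))
    simp

end Equivariance

section Continuity

open Filter Topology

variable {K : Type*} [Field K] {m : ℕ} {v : K → RInf}

lemma gauss_top {σ : Type*} (F : MvPolynomial σ K) (hF : F.coeff 0 = 0) :
    gauss v (fun _ => ⊤) F = ⊤ := by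
  refine top_le_iff.mp (le_gauss fun α hα => ?_)
  have hα0 : α ≠ 0 := by
    rintro rfl
    exact MvPolynomial.mem_support_iff.mp hα hF
  obtain ⟨i, hi⟩ := Finsupp.ne_iff.mp hα0
  have : (α.sum fun i k => k • (⊤ : RInf)) = ⊤ := by
    rw [Finsupp.sum, WithTop.sum_eq_top]
    refine ⟨i, Finsupp.mem_support_iff.mpr hi, ?_⟩
    obtain ⟨n, hn⟩ := Nat.exists_eq_succ_of_ne_zero hi
    rw [hn, succ_nsmul, add_top]
  rw [this, add_top]

lemma gauss_tropMap_le {I : Ideal (MvPolynomial (GrVar m) K)}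
    {w : (MvPolynomial (GrVar m) K ⧸ I) → RInf}
    (hw : w ∈ An v (MvPolynomial (GrVar m) K ⧸ I)) (F : MvPolynomial (GrVar m) K) :
    gauss v (tropMap I w) F ≤ w (Ideal.Quotient.mk I F) := by
  have := le_gauss_of_isVal hw.1 (algebraMap K _)
    (fun i => Ideal.Quotient.mk I (MvPolynomial.X i)) (fun c => (hw.2 c).symm.le)
    (fun i => le_refl (tropMap I w i)) F
  convert this using 2
  have h : Ideal.Quotient.mk I = MvPolynomial.eval₂Hom (algebraMap K _)
      (fun i => Ideal.Quotient.mk I (MvPolynomial.X i)) := by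
    apply MvPolynomial.ringHom_ext
    · intro c
      rw [MvPolynomial.eval₂Hom_C]; rfl
    · intro i
      rw [MvPolynomial.eval₂Hom_X']
  exact congrArg (fun g => g F) h

lemma continuousAt_of_eq_top
    {σ : TropSet v (grIdeal K m) → (MvPolynomial (GrVar m) K ⧸ grIdeal K m) → RInf}
    (hσ : ∀ ξ, σ ξ ∈ An v (MvPolynomial (GrVar m) K ⧸ grIdeal K m))
    (hσ' : ∀ ξ, tropMap (grIdeal K m) (σ ξ) = ξ) {ξ : TropSet v (grIdeal K m)}
    (hξ : (ξ : GrVar m → RInf) = fun _ => ⊤) : ContinuousAt σ ξ := by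
  refine tendsto_pi_nhds.mpr fun f => ?_
  obtain ⟨F, rfl⟩ := Ideal.Quotient.mk_surjective f
  obtain ⟨F₁, hF₁⟩ : ∃ F₁, F₁ = F - MvPolynomial.C (F.coeff 0) := ⟨_, rfl⟩
  have hF : F = MvPolynomial.C (F.coeff 0) + F₁ := by rw [hF₁]; ring
  have hsplit : Ideal.Quotient.mk (grIdeal K m) F
      = algebraMap K _ (F.coeff 0) + Ideal.Quotient.mk _ F₁ := by
    conv_lhs => rw [hF, map_add]
    rfl
  have htop : Tendsto (fun ξ' => σ ξ' (Ideal.Quotient.mk _ F₁)) (𝓝 ξ) (𝓝 ⊤) := by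
    refine tendsto_nhds_top_mono (f := fun ξ' : TropSet v (grIdeal K m) =>
      gauss v (ξ' : GrVar m → RInf) F₁) ?_ (Filter.Eventually.of_forall fun ξ' => ?_)
    · have := ((continuous_gauss v F₁).comp continuous_subtype_val).tendsto ξ
      simp only [Function.comp_apply, hξ] at this
      rwa [gauss_top F₁ (by simp [hF₁])] at this
    · have := gauss_tropMap_le (hσ ξ') F₁
      rwa [hσ'] at this
  have htop' : σ ξ (Ideal.Quotient.mk _ F₁) = ⊤ := by
    have := gauss_tropMap_le (hσ ξ) F₁
    rwa [hσ', hξ, gauss_top F₁ (by simp [hF₁]), top_le_iff] at this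
  rw [hsplit]
  by_cases hc : v (F.coeff 0) = ⊤
  · have hle : ∀ ξ', σ ξ' (Ideal.Quotient.mk _ F₁)
        ≤ σ ξ' (algebraMap K _ (F.coeff 0) + Ideal.Quotient.mk _ F₁) := fun ξ' => by
      have := (hσ ξ').1.min_le_add (algebraMap K _ (F.coeff 0)) (Ideal.Quotient.mk _ F₁)
      rwa [(hσ ξ').2, hc, min_top_left] at this
    rw [top_le_iff.mp (htop'.symm.le.trans (hle ξ))]
    exact tendsto_nhds_top_mono htop (Filter.Eventually.of_forall hle)
  · have heq : ∀ ξ', v (F.coeff 0) < σ ξ' (Ideal.Quotient.mk _ F₁) →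
        σ ξ' (algebraMap K _ (F.coeff 0) + Ideal.Quotient.mk _ F₁) = v (F.coeff 0) :=
      fun ξ' h => by
        rw [← (hσ ξ').2] at h ⊢
        exact (hσ ξ').1.map_add_of_lt h
    rw [heq ξ (by rw [htop']; exact lt_top_iff_ne_top.mpr hc)]
    refine tendsto_const_nhds.congr' ?_
    filter_upwards [htop.eventually_const_lt (lt_top_iff_ne_top.mpr hc)] with ξ' h
    exact (heq ξ' h).symm

lemma continuous_of_isTreeDatum (hv : IsVal v)
    {σ : TropSet v (grIdeal K m) → (MvPolynomial (GrVar m) K ⧸ grIdeal K m) → RInf}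
    {M : TropSet v (grIdeal K m) → Fin m → Finset (Fin m)}
    {p : TropSet v (grIdeal K m) → Fin m → Fin m} {r : TropSet v (grIdeal K m) → Fin m}
    {δ : TropSet v (grIdeal K m) → Fin m → RInf}
    (h : ∀ ξ : TropSet v (grIdeal K m), IsTreeDatum (ξ : GrVar m → RInf) (M ξ) (p ξ) (r ξ) (δ ξ))
    (hδ : ∀ ξ j a b, 0 ≤ δ ξ j + symCoord (ξ : GrVar m → RInf) a b)
    (hσ : ∀ ξ, σ ξ = treeVal v (M ξ) (rowMin ξ) (δ ξ)) : Continuous σ := by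
  rw [continuous_iff_continuousAt]
  intro ξ
  by_cases htop : ∀ a b, symCoord (ξ : GrVar m → RInf) a b = ⊤
  · refine continuousAt_of_eq_top (fun ξ => ?_) (fun ξ => ?_) ?_
    · rw [hσ]; exact treeVal_mem_An hv _ _ _
    · rw [hσ]; exact (h ξ).tropMap_treeVal_eq hv
    · funext e
      rw [← htop e.val.1 e.val.2, symCoord, dif_pos e.prop]
  push Not at htop
  obtain ⟨a, b, hab⟩ := htop
  rw [continuousAt_iff_ultrafilter]
  intro g hg
  have hcoord : Tendsto (fun x : TropSet v (grIdeal K m) => (x : GrVar m → RInf)) g (𝓝 ξ) :=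
    (continuous_subtype_val.tendsto ξ).mono_left hg
  obtain ⟨⟨M₀, p₀, r₀⟩, h₀⟩ := Ultrafilter.eq_pure_of_finite (g.map fun x => (M x, p x, r x))
  have hconst : ∀ᶠ x in (g : Filter _), M x = M₀ ∧ p x = p₀ ∧ r x = r₀ := by
    have : {(M₀, p₀, r₀)} ∈ g.map fun x => (M x, p x, r x) := by
      rw [h₀]; exact Set.mem_singleton _
    filter_upwards [Ultrafilter.mem_map.mp this] with x hx
    simpa using hx
  obtain ⟨R, hR⟩ := RInf.exists_coe hab
  have hbound : ∀ᶠ x in (g : Filter _), ∀ j, ((-(R + 1) : ℝ) : RInf) ≤ δ x j := by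
    have hlt : symCoord (ξ : GrVar m → RInf) a b < ((R + 1 : ℝ) : RInf) := by
      rw [← hR, WithTop.coe_lt_coe]; linarith
    filter_upwards [(((continuous_symCoord a b).tendsto _).comp hcoord).eventually_lt_const hlt]
      with x hx j
    have := (RInf.add_neg_coe_le_iff (a := 0) (R + 1)).mpr
      ((hδ x j a b).trans (add_le_add le_rfl hx.le))
    rwa [zero_add] at this
  obtain ⟨δ₀, -, hδ₀⟩ := (isCompact_univ_pi fun _ : Fin m =>
    (isCompact_Icc (a := ((-(R + 1) : ℝ) : RInf)) (b := ⊤))).ultrafilter_le_nhds (g.map δ) (by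
      rw [Filter.le_principal_iff, Ultrafilter.mem_coe, Ultrafilter.mem_map]
      filter_upwards [hbound] with x hx j _
      exact ⟨hx j, le_top⟩)
  have hδt : Tendsto δ g (𝓝 δ₀) := hδ₀
  have hδj : ∀ j, Tendsto (fun x => δ x j) g (𝓝 (δ₀ j)) := tendsto_pi_nhds.mp hδt
  have hτ : ∀ k, Tendsto (fun x : TropSet v (grIdeal K m) => rowMin (x : GrVar m → RInf) k) g
      (𝓝 (rowMin ξ k)) := fun k => ((continuous_rowMin k).tendsto _).comp hcoord
  have hdatum : ∀ᶠ x : TropSet v (grIdeal K m) in g,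
      IsTreeDatum (x : GrVar m → RInf) M₀ p₀ r₀ (δ x) := by
    filter_upwards [hconst] with x hx
    have := h x
    rwa [hx.1, hx.2.1, hx.2.2] at this
  obtain ⟨x₀, hx₀⟩ := hdatum.exists
  have hlim : IsTreeDatum (ξ : GrVar m → RInf) M₀ p₀ r₀ δ₀ :=
    { root_le := fun k => le_of_tendsto_of_tendsto (hτ _) (hτ _)
        (hdatum.mono fun x hx => hx.root_le k)
      root_eq := hx₀.root_eq
      parent_le := fun k hk => le_of_tendsto_of_tendsto (hτ _) (hτ _)
        (hdatum.mono fun x hx => hx.parent_le k hk)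
      notMem := hx₀.notMem
      eq_insert := hx₀.eq_insert
      symCoord_eq := fun k l hkl => by
        refine tendsto_nhds_unique_of_eventuallyEq
          (((hτ k).add (hτ l)).add (Filter.Tendsto.finset_inf_nhds_apply fun j _ => hδj j))
          (((continuous_symCoord k l).tendsto _).comp hcoord)
          (hdatum.mono fun x hx => hx.symCoord_eq k l hkl) }
  have hval : σ ξ = treeVal v M₀ (rowMin ξ) δ₀ := by
    rw [hσ]; exact (h ξ).treeVal_unique hv hlim
  rw [hval]
  refine tendsto_pi_nhds.mpr fun f => ?_
  refine (((continuous_treeVal v M₀ f).tendsto (rowMin ξ, δ₀)).comp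
    ((tendsto_pi_nhds.mpr hτ).prodMk_nhds hδt)).congr' ?_
  filter_upwards [hconst] with x hx
  rw [hσ, hx.1]
  rfl

end Continuity

/-- The ideal of the cone over `Gr(2,m)` is weight-homogeneous for
the weights `a_{ij} = e_i + e_j`, and `trop : X^an → Trop(X)` admits a continuous,
`ℝ^m`-equivariant section: `σ(ξ + Aτ) = μ(τ, σ(ξ))` where `(Aτ)_{ij} = τ_i + τ_j`. -/
theorem grassmannian_has_equivariant_section
    {K : Type*} [Field K] (v : K → RInf) (hv : IsVal v)
    (hsurj : Function.Surjective v) (m : ℕ) (hm : 2 ≤ m) :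
    WtHomog (grWt m) (grIdeal K m) ∧
    ∃ σ : TropSet v (grIdeal K m) →
        {w : (MvPolynomial (GrVar m) K ⧸ grIdeal K m) → RInf //
          w ∈ An v (MvPolynomial (GrVar m) K ⧸ grIdeal K m)},
      Continuous σ ∧
      (∀ ξ : TropSet v (grIdeal K m),
        tropMap (grIdeal K m) (σ ξ).val = (ξ : GrVar m → RInf)) ∧
      (∀ (ξ : TropSet v (grIdeal K m)) (τ : Fin m → ℝ),
        ∃ h : (fun e : GrVar m =>
            (ξ : GrVar m → RInf) e + ((τ e.val.1 + τ e.val.2 : ℝ) : RInf))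
              ∈ TropSet v (grIdeal K m),
          ((σ ⟨_, h⟩ : {w : (MvPolynomial (GrVar m) K ⧸ grIdeal K m) → RInf //
              w ∈ An v (MvPolynomial (GrVar m) K ⧸ grIdeal K m)}) : _).val
            = mu (grWt m) (grIdeal K m) τ (σ ξ).val) := by
  have : NeZero m := ⟨by omega⟩
  refine ⟨wtHomog_grIdeal, ?_⟩
  choose M p r δ h hδ using fun ξ : TropSet v (grIdeal K m) => exists_isTreeDatum ξ.prop
  refine ⟨fun ξ => ⟨treeVal v (M ξ) (rowMin ξ) (δ ξ), treeVal_mem_An hv _ _ _⟩,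
    (continuous_of_isTreeDatum hv h hδ fun _ => rfl).subtype_mk _,
    fun ξ => (h ξ).tropMap_treeVal_eq hv, fun ξ τ => ⟨?_, ?_⟩⟩
  · exact ⟨_, treeVal_mem_An hv (M ξ) (fun j => rowMin ξ j + (τ j : RInf)) (δ ξ), by
      rw [tropMap_treeVal_shift hv, (h ξ).tropMap_treeVal_eq hv]⟩
  · exact (h ξ).treeVal_shift hv τ (h ⟨_, _⟩)
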